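/- arXiv:2002.05483 — 2 statements merged into one kernel-verified Lean document; each statement's English description precedes it below -/
import Mathlib

section
/- (Proposition 2.16) Let A be a finite abelian probability group with |A| = m+1. Then for all 0 ≤ j₁, j₂, k ≤ m the dual structure constants satisfy p̂_k(j₁, j₂) = (1/n_k)·Σ_{a∈A} h_a·μ_{j₁}(a)·μ_{j₂}(a)·μ_k(a*). -/
open Finset

/-- A probability group: a finite set `A` with `p : A × A × A → ℝ`
(written `p a b c` for `p(a.b = c)`), an identity element `one` and an
involution `star` satisfying the axioms of Harrison. -/
structure ProbabilityGroup (A : Type*) [Fintype A] where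
  /-- the structure function `p(a.b = c)` -/
  p : A → A → A → ℝ
  /-- the identity element `1` -/
  one : A
  /-- the involution `a ↦ a*` -/
  star : A → A
  nonneg : ∀ a b c, 0 ≤ p a b c
  sum_eq_one : ∀ a b, ∑ c, p a b c = 1
  assoc : ∀ a b c d, ∑ x, p a b x * p x c d = ∑ y, p a y d * p b c y
  one_mul : ∀ a, p one a a = 1
  mul_one : ∀ a, p a one a = 1
  star_pos : ∀ b, 0 < p b (star b) one
  star_unique : ∀ b b', 0 < p b b' one → b' = star b
  p_star : ∀ a b c, p a b c = p (star b) (star a) (star c)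
  star_symm : ∀ a, p a (star a) one = p (star a) a one

variable {A : Type*} [Fintype A] [DecidableEq A]

/-- The multiplication of `ℂ[A]` (realized as `A → ℂ` via coordinates in the
basis `A`): on basis elements, `a·b = ∑ c, p(a.b = c) • c`. -/
noncomputable def Pmul (G : ProbabilityGroup A) (f g : A → ℂ) : A → ℂ :=
  fun c => ∑ a : A, ∑ b : A, f a * g b * (G.p a b c : ℂ)

/-- The basis element of `ℂ[A]` corresponding to `a ∈ A`. -/
def delta (a : A) : A → ℂ := fun c => if c = a then 1 else 0

/-- The weight `h_a := 1 / p(a.a* = 1)`. -/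
noncomputable def wt (G : ProbabilityGroup A) (a : A) : ℝ :=
  1 / G.p a (G.star a) G.one

/-- The total weight `n(A) := ∑ a, h_a`. -/
noncomputable def nPG (G : ProbabilityGroup A) : ℝ := ∑ a : A, wt G a

/-- The normalized idempotent `u_A := (1/n(A)) ∑ a, h_a • a`. -/
noncomputable def uA (G : ProbabilityGroup A) : A → ℂ :=
  fun a => ((wt G a / nPG G : ℝ) : ℂ)

namespace ProbabilityGroup

variable (G : ProbabilityGroup A)

omit [DecidableEq A] in
theorem star_star (a : A) : G.star (G.star a) = a :=
  (G.star_unique (G.star a) a (G.star_symm a ▸ G.star_pos a)).symm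

omit [DecidableEq A] in
theorem p_star_one_eq_zero {a b : A} (h : b ≠ a) : G.p b (G.star a) G.one = 0 := by
  refine le_antisymm (not_lt.mp fun hpos => h ?_) (G.nonneg _ _ _)
  rw [← G.star_star a, G.star_unique b _ hpos, G.star_star]

theorem Pmul_delta_star_apply_one (f : A → ℂ) (a : A) :
    Pmul G f (delta (G.star a)) G.one = f a * (G.p a (G.star a) G.one : ℂ) := by
  simp only [Pmul, delta, mul_ite, _root_.mul_one, mul_zero, ite_mul, zero_mul,
    Finset.sum_ite_eq', Finset.mem_univ, if_true]
  refine Finset.sum_eq_single_of_mem a (Finset.mem_univ a) fun b _ hb => ?_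
  rw [G.p_star_one_eq_zero hb, Complex.ofReal_zero, mul_zero]

theorem wt_mul_Pmul_delta_star_apply_one (f : A → ℂ) (a : A) :
    (wt G a : ℂ) * Pmul G f (delta (G.star a)) G.one = f a := by
  have h : (G.p a (G.star a) G.one : ℂ) ≠ 0 := Complex.ofReal_ne_zero.mpr (G.star_pos a).ne'
  rw [Pmul_delta_star_apply_one, wt, Complex.ofReal_div, Complex.ofReal_one]
  field_simp

end ProbabilityGroup

theorem IsLinearMap.eq_sum_mul_delta {φ : (A → ℂ) → ℂ} (hφ : IsLinearMap ℂ φ) (f : A → ℂ) :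
    φ f = ∑ a, f a * φ (delta a) := by
  have h : f = ∑ a, f a • delta a := by
    ext c
    simp [delta]
  calc φ f = hφ.mk' φ (∑ a, f a • delta a) := by rw [← h]; rfl
    _ = ∑ a, f a * φ (delta a) := by simp

omit [DecidableEq A] in
/-- Functionals with a dual family, as many as the dimension, separate points. -/
theorem eq_of_forall_functional_eq {ι : Type*} [Fintype ι] [DecidableEq ι]
    (hcard : Fintype.card A = Fintype.card ι) {μ : ι → (A → ℂ) → ℂ}
    (hμ : ∀ j, IsLinearMap ℂ (μ j)) {F : ι → A → ℂ}
    (hF : ∀ i j, μ i (F j) = if i = j then 1 else 0) {x y : A → ℂ}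
    (h : ∀ i, μ i x = μ i y) : x = y := by
  let Φ : (A → ℂ) →ₗ[ℂ] ι → ℂ := LinearMap.pi fun i => (hμ i).mk' (μ i)
  have hsurj : Function.Surjective Φ := fun v => by
    refine ⟨∑ j, v j • F j, ?_⟩
    ext i
    simp [Φ, hF]
  have hinj : Function.Injective Φ :=
    (LinearMap.injective_iff_surjective_of_finrank_eq_finrank (by simp [hcard])).mpr hsurj
  exact hinj (funext h)

/-- Proposition 2.16: For a finite abelian probability group `A`
with `|A| = m+1`, the dual structure constants `p̂_k(j₁,j₂)`, defined by
`μ_{j₁} ⋆ μ_{j₂} = ∑_k p̂_k(j₁,j₂)·μ_k`, satisfy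
`p̂_k(j₁,j₂) = (1/n_k) ∑_{a∈A} h_a·μ_{j₁}(a)·μ_{j₂}(a)·μ_k(a*)`. -/
theorem stmt_9 {A : Type*} [Fintype A] [DecidableEq A] (m : ℕ)
    (G : ProbabilityGroup A)
    -- `A` is abelian
    (hab : ∀ a b c : A, G.p a b c = G.p b a c)
    -- `|A| = m + 1`
    (hcard : Fintype.card A = m + 1)
    -- `μ_0, …, μ_m` are the distinct `ℂ`-algebra homomorphisms `ℂ[A] → ℂ`:
    (μ : Fin (m + 1) → (A → ℂ) → ℂ)
    (hμlin : ∀ j, IsLinearMap ℂ (μ j))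
    (hμmul : ∀ j, ∀ x y : A → ℂ, μ j (Pmul G x y) = μ j x * μ j y)
    (hμunit : ∀ j, μ j (delta G.one) = 1)
    (hμinj : Function.Injective μ)
    (hμall : ∀ ν : (A → ℂ) → ℂ, IsLinearMap ℂ ν →
      (∀ x y : A → ℂ, ν (Pmul G x y) = ν x * ν y) → ν (delta G.one) = 1 →
      ∃ j, ν = μ j)
    -- `F_0, …, F_m` are the primitive idempotents, `μ_i(F_j) = δ_{ij}`, `∑ F_j = 1`:
    (F : Fin (m + 1) → (A → ℂ))
    (hF : ∀ i j, μ i (F j) = if i = j then 1 else 0)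
    (hFsum : ∑ j, F j = delta G.one)
    -- the nonzero scalars `n_j` with `τ(F_j) = 1/n_j`:
    (n : Fin (m + 1) → ℂ)
    (hn : ∀ j, n j ≠ 0)
    (hτF : ∀ j, F j G.one = 1 / n j)
    -- the dual structure constants `p̂_k(i,j)`:
    (phat : Fin (m + 1) → Fin (m + 1) → Fin (m + 1) → ℂ)
    (hphat : ∀ i j, ∀ a : A,
      μ i (delta a) * μ j (delta a) = ∑ k, phat k i j * μ k (delta a)) :
    ∀ j₁ j₂ k, phat k j₁ j₂
      = (1 / n k) * ∑ a : A,
          (wt G a : ℂ) * (μ j₁ (delta a) * μ j₂ (delta a) * μ k (delta (G.star a))) := by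
  intro j₁ j₂ k
  have hFmul (x : A → ℂ) : Pmul G (F k) x = μ k x • F k := by
    refine eq_of_forall_functional_eq (by simpa using hcard) hμlin hF fun i => ?_
    rw [hμmul, (hμlin i).map_smul, hF, smul_eq_mul]
    split_ifs with hik
    · rw [hik, one_mul, mul_one]
    · rw [zero_mul, mul_zero]
  have hFcoeff (a : A) : F k a = 1 / n k * (wt G a * μ k (delta (G.star a))) := by
    rw [← G.wt_mul_Pmul_delta_star_apply_one (F k) a, hFmul, Pi.smul_apply, hτF, smul_eq_mul]
    ring
  calc phat k j₁ j₂ = ∑ l, phat l j₁ j₂ * μ l (F k) := by simp [hF]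
    _ = ∑ a, F k a * ∑ l, phat l j₁ j₂ * μ l (delta a) := by
      simp_rw [(hμlin _).eq_sum_mul_delta (F k), Finset.mul_sum]
      rw [Finset.sum_comm]
      exact Finset.sum_congr rfl fun a _ => Finset.sum_congr rfl fun l _ => by ring
    _ = _ := by
      rw [Finset.mul_sum]
      refine Finset.sum_congr rfl fun a _ => ?_
      rw [← hphat, hFcoeff]
      ring
end

section
/- (Corollary 2.18) Let A be a finite abelian probability group with |A| = m+1, with μ_0 the augmentation a ↦ 1, and for each j let j* denote the unique index with μ_{j*}(a) = conj(μ_j(a)) for all a ∈ A. Then for all 0 ≤ j₁, j₂ ≤ m one has p̂_0(j₁, j₂) = (n_{j₁}/n(A))·δ_{j₁, j₂*}. In particular p̂_0(j, j*) = n_j/n(A) and ĥ_j := 1/p̂_0(j, j*) = n(A)/n_j for every j. -/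
open Finset

variable {A : Type*} [Fintype A] [DecidableEq A]

namespace ProbabilityGroup

theorem star_star_s10 {B : Type*} [Fintype B] (G : ProbabilityGroup B) (a : B) : G.star (G.star a) = a :=
  (G.star_unique _ _ (G.star_symm a ▸ G.star_pos a)).symm

theorem star_one {B : Type*} [Fintype B] (G : ProbabilityGroup B) : G.star G.one = G.one :=
  (G.star_unique _ _ (by rw [G.one_mul]; exact one_pos)).symm

theorem p_one_eq_zero {B : Type*} [Fintype B] (G : ProbabilityGroup B) {a b : B} (h : b ≠ G.star a) :
    G.p a b G.one = 0 :=
  le_antisymm (not_lt.mp fun hp => h (G.star_unique _ _ hp)) (G.nonneg _ _ _)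

theorem wt_pos {B : Type*} [Fintype B] (G : ProbabilityGroup B) (a : B) : 0 < wt G a :=
  one_div_pos.mpr (G.star_pos a)

theorem Pmul_comp_star {B : Type*} [Fintype B] (G : ProbabilityGroup B)
    (hab : ∀ a b c, G.p a b c = G.p b a c)
    (x y : B → ℂ) : Pmul G (x ∘ G.star) (y ∘ G.star) = Pmul G x y ∘ G.star := by
  funext c
  have hs : Function.Involutive G.star := G.star_star_s10
  simp only [Pmul, Function.comp_apply]
  refine Fintype.sum_equiv hs.toPerm _ _ fun a => Fintype.sum_equiv hs.toPerm _ _ fun b => ?_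
  rw [Function.Involutive.coe_toPerm, G.p_star a b c, hab (G.star b)]

/-- The coefficient of `1` in `x · a*` is the coefficient of `a` in `x`, up to the weight. -/
theorem wt_mul_Pmul_delta_star_one (G : ProbabilityGroup A) (x : A → ℂ) (a : A) :
    (wt G a : ℂ) * Pmul G x (delta (G.star a)) G.one = x a := by
  have hs : Function.Involutive G.star := G.star_star_s10
  have hp : (G.p a (G.star a) G.one : ℂ) ≠ 0 := by
    exact_mod_cast (G.star_pos a).ne'
  have key : Pmul G x (delta (G.star a)) G.one = x a * (G.p a (G.star a) G.one : ℂ) := by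
    simp only [Pmul, delta, mul_ite, ite_mul, _root_.mul_one, mul_zero, zero_mul,
      Finset.sum_ite_eq', Finset.mem_univ, if_true]
    refine Finset.sum_eq_single a (fun b _ hb => ?_) (by simp)
    rw [G.p_one_eq_zero fun h => hb (hs.injective h).symm]
    simp
  rw [key, wt]
  push_cast
  field_simp

end ProbabilityGroup

theorem IsLinearMap.eq_sum_delta {φ : (A → ℂ) → ℂ} (hφ : IsLinearMap ℂ φ) (x : A → ℂ) :
    φ x = ∑ a, x a * φ (delta a) := by
  have hx : x = ∑ a, x a • delta a := by
    funext c
    simp [delta, Finset.sum_apply]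
  conv_lhs => rw [hx]
  change hφ.mk' φ _ = _
  rw [map_sum]
  simp

/-- Functionals with a dual family of the full cardinality separate points. -/
theorem eq_of_dual_family {B ι : Type*} [Fintype B] [Fintype ι] [DecidableEq ι]
    (hcard : Fintype.card B = Fintype.card ι) {μ : ι → (B → ℂ) → ℂ}
    (hμ : ∀ j, IsLinearMap ℂ (μ j)) {F : ι → B → ℂ}
    (hF : ∀ i j, μ i (F j) = if i = j then 1 else 0) {x y : B → ℂ}
    (h : ∀ i, μ i x = μ i y) : x = y := by
  let L : (B → ℂ) →ₗ[ℂ] (ι → ℂ) := LinearMap.pi fun i => (hμ i).mk' (μ i)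
  have hL : ∀ z i, L z i = μ i z := fun _ _ => rfl
  have hsurj : Function.Surjective L := fun v => by
    refine ⟨∑ j, v j • F j, funext fun i => ?_⟩
    rw [map_sum, Finset.sum_apply]
    simp [hL, (hμ _).map_smul, hF]
  have hinj : Function.Injective L :=
    (LinearMap.injective_iff_surjective_of_finrank_eq_finrank (by simp [hcard])).mpr hsurj
  exact hinj (funext h)

namespace ProbabilityGroup

/-- The coefficients of the primitive idempotents, in terms of the characters. -/
theorem idempotent_apply (G : ProbabilityGroup A) {ι : Type*} [Fintype ι] [DecidableEq ι]
    (hcard : Fintype.card A = Fintype.card ι) {μ : ι → (A → ℂ) → ℂ}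
    (hμlin : ∀ j, IsLinearMap ℂ (μ j))
    (hμmul : ∀ j x y, μ j (Pmul G x y) = μ j x * μ j y) {F : ι → A → ℂ}
    (hF : ∀ i j, μ i (F j) = if i = j then 1 else 0) (j : ι) (a : A) :
    F j a = wt G a * (μ j (delta (G.star a)) * F j G.one) := by
  have h : Pmul G (F j) (delta (G.star a)) = μ j (delta (G.star a)) • F j := by
    refine eq_of_dual_family hcard hμlin hF fun i => ?_
    rw [hμmul, (hμlin i).map_smul, hF]
    split_ifs with hij <;> simp [hij]
  rw [← G.wt_mul_Pmul_delta_star_one (F j) a, h, Pi.smul_apply, smul_eq_mul]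

/-- Orthogonality relations for the characters. -/
theorem sum_wt_mul_character (G : ProbabilityGroup A) {ι : Type*} [Fintype ι] [DecidableEq ι]
    (hcard : Fintype.card A = Fintype.card ι) {μ : ι → (A → ℂ) → ℂ}
    (hμlin : ∀ j, IsLinearMap ℂ (μ j))
    (hμmul : ∀ j x y, μ j (Pmul G x y) = μ j x * μ j y) {F : ι → A → ℂ}
    (hF : ∀ i j, μ i (F j) = if i = j then 1 else 0) {n : ι → ℂ} (hn : ∀ j, n j ≠ 0)
    (hτF : ∀ j, F j G.one = 1 / n j) (i j : ι) :
    ∑ a, (wt G a : ℂ) * μ j (delta (G.star a)) * μ i (delta a) = if i = j then n j else 0 := by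
  have h := (hμlin i).eq_sum_delta (F j)
  rw [hF] at h
  calc _ = n j * ∑ a, F j a * μ i (delta a) := by
        rw [Finset.mul_sum]
        refine Finset.sum_congr rfl fun a _ => ?_
        rw [G.idempotent_apply hcard hμlin hμmul hF, hτF]
        have := hn j
        field_simp
    _ = _ := by rw [← h]; simp

end ProbabilityGroup

/-- Corollary 2.18: For a finite abelian probability group `A`
with `|A| = m+1`, with `μ_0` the augmentation and `j ↦ j*` the involution on
indices with `μ_{j*}(a) = conj(μ_j(a))`, one has
`p̂_0(j₁,j₂) = (n_{j₁}/n(A))·δ_{j₁,j₂*}`; in particular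
`p̂_0(j,j*) = n_j/n(A)` and `ĥ_j = 1/p̂_0(j,j*) = n(A)/n_j`. -/
theorem stmt_10 {A : Type*} [Fintype A] [DecidableEq A] (m : ℕ)
    (G : ProbabilityGroup A)
    -- `A` is abelian
    (hab : ∀ a b c : A, G.p a b c = G.p b a c)
    -- `|A| = m + 1`
    (hcard : Fintype.card A = m + 1)
    -- `μ_0, …, μ_m` are the distinct `ℂ`-algebra homomorphisms `ℂ[A] → ℂ`:
    (μ : Fin (m + 1) → (A → ℂ) → ℂ)
    (hμlin : ∀ j, IsLinearMap ℂ (μ j))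
    (hμmul : ∀ j, ∀ x y : A → ℂ, μ j (Pmul G x y) = μ j x * μ j y)
    (hμunit : ∀ j, μ j (delta G.one) = 1)
    (hμinj : Function.Injective μ)
    (hμall : ∀ ν : (A → ℂ) → ℂ, IsLinearMap ℂ ν →
      (∀ x y : A → ℂ, ν (Pmul G x y) = ν x * ν y) → ν (delta G.one) = 1 →
      ∃ j, ν = μ j)
    -- `F_0, …, F_m` are the primitive idempotents, `μ_i(F_j) = δ_{ij}`, `∑ F_j = 1`:
    (F : Fin (m + 1) → (A → ℂ))
    (hF : ∀ i j, μ i (F j) = if i = j then 1 else 0)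
    (hFsum : ∑ j, F j = delta G.one)
    -- the nonzero scalars `n_j` with `τ(F_j) = 1/n_j`:
    (n : Fin (m + 1) → ℂ)
    (hn : ∀ j, n j ≠ 0)
    (hτF : ∀ j, F j G.one = 1 / n j)
    -- `μ_0` is the augmentation `a ↦ 1`:
    (hμ0 : ∀ a : A, μ 0 (delta a) = 1)
    -- the dual structure constants `p̂_k(i,j)`:
    (phat : Fin (m + 1) → Fin (m + 1) → Fin (m + 1) → ℂ)
    (hphat : ∀ i j, ∀ a : A,
      μ i (delta a) * μ j (delta a) = ∑ k, phat k i j * μ k (delta a))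
    -- the involution `j ↦ j*` on the index set:
    (jstar : Fin (m + 1) → Fin (m + 1))
    (hjstar : ∀ j, ∀ a : A, μ (jstar j) (delta a) = starRingEnd ℂ (μ j (delta a))) :
    (∀ j₁ j₂, phat 0 j₁ j₂
        = (n j₁ / (nPG G : ℂ)) * (if j₁ = jstar j₂ then 1 else 0)) ∧
    (∀ j, phat 0 j (jstar j) = n j / (nPG G : ℂ)
        ∧ 1 / phat 0 j (jstar j) = (nPG G : ℂ) / n j) := by
  have hcard' : Fintype.card A = Fintype.card (Fin (m + 1)) := by simpa using hcard
  have orth := G.sum_wt_mul_character hcard' hμlin hμmul hF hn hτF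
  have hμext : ∀ i j, (∀ a, μ i (delta a) = μ j (delta a)) → i = j := fun i j h => by
    refine hμinj (funext fun x => ?_)
    rw [(hμlin i).eq_sum_delta, (hμlin j).eq_sum_delta]
    simp only [h]
  have hstar : ∀ j a, μ j (delta (G.star a)) = μ (jstar j) (delta a) := by
    intro j
    have hdelta : ∀ a : A, delta a ∘ G.star = delta (G.star a) := fun a => by
      funext c
      have : G.star c = a ↔ c = G.star a :=
        ⟨fun h => by rw [← h, G.star_star_s10], fun h => by rw [h, G.star_star_s10]⟩
      simp [delta, this]
    obtain ⟨i, hi⟩ := hμall (fun x => μ (jstar j) (x ∘ G.star))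
      ⟨fun x y => (hμlin _).map_add (x ∘ G.star) (y ∘ G.star),
        fun c x => (hμlin _).map_smul c (x ∘ G.star)⟩
      (fun x y => by rw [← G.Pmul_comp_star hab, hμmul])
      (by rw [hdelta, G.star_one, hμunit])
    have hi' : ∀ a, μ i (delta a) = starRingEnd ℂ (μ j (delta (G.star a))) := fun a => by
      rw [← hi, ← hjstar, ← hdelta]
    have hij : i = j := by
      by_contra hne
      have h0 := orth i j
      rw [if_neg hne] at h0
      have hsum : ∑ a, wt G a * Complex.normSq (μ j (delta (G.star a))) = 0 := by
        rw [← Complex.ofReal_eq_zero, ← h0]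
        push_cast
        refine Finset.sum_congr rfl fun a _ => ?_
        rw [hi', mul_assoc, Complex.mul_conj]
      have h1 := (Finset.sum_eq_zero_iff_of_nonneg fun a _ =>
        mul_nonneg (G.wt_pos a).le (Complex.normSq_nonneg _)).mp hsum G.one (Finset.mem_univ _)
      rw [G.star_one, hμunit, map_one, mul_one] at h1
      exact (G.wt_pos _).ne' h1
    subst hij
    intro a
    rw [hjstar, hi' a, Complex.conj_conj]
  have hinv : ∀ j, jstar (jstar j) = j := fun j =>
    hμext _ _ fun a => by rw [hjstar, hjstar, Complex.conj_conj]
  have hn0 : (nPG G : ℂ) = n 0 := by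
    have h := orth 0 0
    simpa [hμ0, nPG] using h
  have hF0 : ∀ a, F 0 a = wt G a / n 0 := fun a => by
    rw [G.idempotent_apply hcard' hμlin hμmul hF, hμ0, hτF]
    ring
  have hp : ∀ i j, phat 0 i j = ∑ a, F 0 a * (μ i (delta a) * μ j (delta a)) := fun i j => by
    simp only [hphat, Finset.mul_sum]
    rw [Finset.sum_comm]
    have : ∀ k, ∑ a, F 0 a * (phat k i j * μ k (delta a)) = phat k i j * μ k (F 0) := fun k => by
      rw [(hμlin k).eq_sum_delta (F 0), Finset.mul_sum]
      exact Finset.sum_congr rfl fun a _ => by ring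
    simp [this, hF]
  have main : ∀ i j, phat 0 i j = n i / (nPG G : ℂ) * (if i = jstar j then 1 else 0) := by
    intro i j
    have h := orth i (jstar j)
    simp only [hstar, hinv] at h
    calc phat 0 i j
        = (∑ a, (wt G a : ℂ) * μ j (delta a) * μ i (delta a)) / n 0 := by
          rw [hp, Finset.sum_div]
          refine Finset.sum_congr rfl fun a _ => ?_
          rw [hF0]
          ring
      _ = _ := by
          rw [h, hn0]
          split_ifs with hij <;> simp [hij]
  have hdiag : ∀ j, phat 0 j (jstar j) = n j / (nPG G : ℂ) := fun j => by
    rw [main, hinv, if_pos rfl, mul_one]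
  exact ⟨main, fun j => ⟨hdiag j, by rw [hdiag, one_div_div]⟩⟩
end
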